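/- The supremum of I_A(ν) over all ν ∈ G_A^max with ν ≠ δ_{e_1} and ν ≠ δ_{−e_1} equals Q_A := max{e^{λ_2}, cosh λ_1}, and moreover Q_A < e^{λ_1}. -/

import Mathlib

open MeasureTheory Real Filter Topology

noncomputable section

/-- The unit sphere `S = 𝕊^{d-1}` in `ℝ^d`. -/
abbrev Sph (d : ℕ) : Type := Metric.sphere (0 : EuclideanSpace ℝ (Fin d)) 1

variable {d : ℕ}

/-- The bilinear form `⟨x, A y⟩` for the diagonal matrix `A = diag lam`. -/
def qA (lam : Fin d → ℝ) (x y : EuclideanSpace ℝ (Fin d)) : ℝ :=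
  ∑ i, lam i * x i * y i

/-- The interaction kernel `K_A(x,y) = exp ⟨x, A y⟩`. -/
def Kker (lam : Fin d → ℝ) (x y : Sph d) : ℝ :=
  Real.exp (qA lam (x : EuclideanSpace ℝ (Fin d)) (y : EuclideanSpace ℝ (Fin d)))

/-- The interaction energy `I_A(μ)`. -/
def IA (lam : Fin d → ℝ) (μ : Measure (Sph d)) : ℝ :=
  ∫ x, ∫ y, Kker lam x y ∂μ ∂μ

/-- The potential `W_μ(x) = ∫ K_A(x,y) dμ(y)`. -/
def WA (lam : Fin d → ℝ) (μ : Measure (Sph d)) (x : Sph d) : ℝ :=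
  ∫ y, Kker lam x y ∂μ

open scoped Classical in
/-- Relative entropy of `μ` with respect to `ω`, with value `+∞` when `μ` is not
absolutely continuous w.r.t. `ω` or the entropy integral diverges. -/
def Ent (ω μ : Measure (Sph d)) : EReal :=
  if μ ≪ ω ∧ Integrable (fun x => Real.log (μ.rnDeriv ω x).toReal) μ
  then ((∫ x, Real.log (μ.rnDeriv ω x).toReal ∂μ : ℝ) : EReal)
  else ⊤

/-- The free energy `E_{ε,A}(μ) = ε·Ent(μ) − (1/2)·I_A(μ)`. -/
def EA (lam : Fin d → ℝ) (ω : Measure (Sph d)) (ε : ℝ) (μ : Measure (Sph d)) : EReal :=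
  (ε : EReal) * Ent ω μ - ((IA lam μ / 2 : ℝ) : EReal)

/-- The antipodal map on the sphere. -/
def antip (x : Sph d) : Sph d :=
  ⟨-(x : EuclideanSpace ℝ (Fin d)), by
    have hx := x.2
    rw [mem_sphere_zero_iff_norm] at hx ⊢
    rwa [norm_neg]⟩

/-- The sphere self-map induced by a linear isometry equivalence of `ℝ^d`. -/
def sphMap (g : EuclideanSpace ℝ (Fin d) ≃ₗᵢ[ℝ] EuclideanSpace ℝ (Fin d)) (x : Sph d) : Sph d :=
  ⟨g (x : EuclideanSpace ℝ (Fin d)), by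
    have hx := x.2
    rw [mem_sphere_zero_iff_norm] at hx ⊢
    rwa [g.norm_map]⟩

/-- `ω` is the uniform probability measure on the sphere, characterised as a
rotation-invariant Borel probability measure. -/
def IsUniform (ω : Measure (Sph d)) : Prop :=
  IsProbabilityMeasure ω ∧
  ∀ g : EuclideanSpace ℝ (Fin d) ≃ₗᵢ[ℝ] EuclideanSpace ℝ (Fin d),
    Measure.map (sphMap g) ω = ω

/-- The (topological) support of a measure. -/
def msupport (μ : Measure (Sph d)) : Set (Sph d) :=
  {x | ∀ U : Set (Sph d), IsOpen U → x ∈ U → 0 < μ U}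

/-- The set of global maximizers of the potential `W_ν`. -/
def argmaxW (lam : Fin d → ℝ) (ν : Measure (Sph d)) : Set (Sph d) :=
  {x | ∀ y, WA lam ν y ≤ WA lam ν x}

/-- `μ` is a Gibbs critical point of `E_{ε,A}`. -/
def IsGibbs (lam : Fin d → ℝ) (ω : Measure (Sph d)) (ε : ℝ) (μ : Measure (Sph d)) : Prop :=
  IsProbabilityMeasure μ ∧
  μ = ω.withDensity (fun x => ENNReal.ofReal
    (Real.exp (WA lam μ x / ε) / ∫ z, Real.exp (WA lam μ z / ε) ∂ω))

/-- `μ` is a global minimizer of `E_{ε,A}` over Borel probability measures. -/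
def IsMinimizer (lam : Fin d → ℝ) (ω : Measure (Sph d)) (ε : ℝ) (μ : Measure (Sph d)) : Prop :=
  IsProbabilityMeasure μ ∧
  ∀ ν : Measure (Sph d), IsProbabilityMeasure ν → EA lam ω ε μ ≤ EA lam ω ε ν

/-- `m_ε`, the infimum of the free energy over probability measures. -/
def mEps (lam : Fin d → ℝ) (ω : Measure (Sph d)) (ε : ℝ) : EReal :=
  sInf {r : EReal | ∃ μ : Measure (Sph d), IsProbabilityMeasure μ ∧ EA lam ω ε μ = r}


lemma cont_int {X : Type*} [TopologicalSpace X] [CompactSpace X] [MeasurableSpace X] [OpensMeasurableSpace X]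
    (ν : Measure X) [IsFiniteMeasure ν] {f : X → ℝ} (hf : Continuous f) : Integrable f ν :=
  hf.integrable_of_hasCompactSupport (HasCompactSupport.of_compactSpace f)

def mono {n : ℕ} (k : Fin n → Fin d) (x : Sph d) : ℝ := ∏ j, x.1 (k j)

lemma cont_coord (i : Fin d) : Continuous (fun x : Sph d => x.1 i) := by fun_prop

lemma cont_mono {n : ℕ} (k : Fin n → Fin d) : Continuous (mono k) := by
  unfold mono
  fun_prop

lemma cont_q (lam : Fin d → ℝ) (x : Sph d) : Continuous (fun y : Sph d => qA lam x.1 y.1) := by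
  unfold qA
  fun_prop

lemma cont_K (lam : Fin d → ℝ) (x : Sph d) : Continuous (Kker lam x) := by
  have := cont_q lam x
  unfold Kker
  fun_prop

lemma q_pow (lam : Fin d → ℝ) (x y : Sph d) (n : ℕ) :
    qA lam x.1 y.1 ^ n = ∑ k : Fin n → Fin d, (∏ j, lam (k j)) * mono k x * mono k y := by
  unfold qA mono
  rw [Fintype.sum_pow]
  refine Finset.sum_congr rfl fun k _ => ?_
  simp only [Finset.prod_mul_distrib]

lemma sum_sq (x : Sph d) : ∑ i, x.1 i ^ 2 = 1 := by
  have h := EuclideanSpace.norm_sq_eq x.1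
  have hx : ‖x.1‖ = 1 := mem_sphere_zero_iff_norm.1 x.2
  rw [hx] at h
  simp only [Real.norm_eq_abs, sq_abs] at h
  linarith

lemma coord_sq_le (x : Sph d) (i : Fin d) : x.1 i ^ 2 ≤ 1 := by
  exact (Finset.single_le_sum (f := fun i => x.1 i ^ 2) (fun i _ => sq_nonneg _)
    (Finset.mem_univ i)).trans (sum_sq x).le

lemma q_abs (lam : Fin d → ℝ) (x y : Sph d) : |qA lam x.1 y.1| ≤ ∑ i, |lam i| := by
  unfold qA
  refine (Finset.abs_sum_le_sum_abs _ _).trans (Finset.sum_le_sum fun i _ => ?_)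
  have h1 : |x.1 i| ≤ 1 := abs_le_one_iff_mul_self_le_one.2 (by have := coord_sq_le x i; nlinarith)
  have h2 : |y.1 i| ≤ 1 := abs_le_one_iff_mul_self_le_one.2 (by have := coord_sq_le y i; nlinarith)
  rw [abs_mul, abs_mul, mul_assoc]
  have : |x.1 i| * |y.1 i| ≤ 1 := mul_le_one₀ h1 (abs_nonneg _) h2
  nlinarith [abs_nonneg (lam i)]

lemma hasSum_K (lam : Fin d → ℝ) (x y : Sph d) :
    HasSum (fun n : ℕ => qA lam x.1 y.1 ^ n / n.factorial) (Kker lam x y) := by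
  unfold Kker
  rw [Real.exp_eq_exp_ℝ]
  exact NormedSpace.expSeries_div_hasSum_exp _

lemma int_q_pow (lam : Fin d → ℝ) (ν : Measure (Sph d)) [IsProbabilityMeasure ν] (x : Sph d) (n : ℕ) :
    ∫ y, qA lam x.1 y.1 ^ n / n.factorial ∂ν =
      (∑ k : Fin n → Fin d, (∏ j, lam (k j)) * mono k x * ∫ y, mono k y ∂ν) / n.factorial := by
  rw [integral_div]
  simp only [q_pow]
  rw [integral_finsetSum]
  · simp only [integral_const_mul]
  · intro k _
    exact (cont_int ν (cont_mono k)).const_mul _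

lemma bound_q (lam : Fin d → ℝ) (x y : Sph d) (n : ℕ) :
    ‖qA lam x.1 y.1 ^ n / n.factorial‖ ≤ (∑ i, |lam i|) ^ n / n.factorial := by
  rw [norm_div, norm_pow, Real.norm_eq_abs, Real.norm_eq_abs, Nat.abs_cast]
  gcongr
  exact q_abs lam x y

lemma hasSum_W (lam : Fin d → ℝ) (ν : Measure (Sph d)) [IsProbabilityMeasure ν] (x : Sph d) :
    HasSum (fun n : ℕ => ∫ y, qA lam x.1 y.1 ^ n / n.factorial ∂ν) (WA lam ν x) := by
  refine hasSum_integral_of_dominated_convergence (fun n _ => (∑ i, |lam i|) ^ n / n.factorial)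
    ?_ ?_ ?_ ?_ ?_
  · intro n
    exact (((cont_q lam x).pow n).div_const _).aestronglyMeasurable
  · intro n
    exact Eventually.of_forall fun y => bound_q lam x y n
  · exact Eventually.of_forall fun y => Real.summable_pow_div_factorial _
  · exact integrable_const _
  · exact Eventually.of_forall fun y => hasSum_K lam x y

lemma hasSum_I (lam : Fin d → ℝ) (ν : Measure (Sph d)) [IsProbabilityMeasure ν] :
    HasSum (fun n : ℕ => ∫ x, ∫ y, qA lam x.1 y.1 ^ n / n.factorial ∂ν ∂ν) (IA lam ν) := by
  refine hasSum_integral_of_dominated_convergence (fun n _ => (∑ i, |lam i|) ^ n / n.factorial)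
    ?_ ?_ ?_ ?_ ?_
  · intro n
    simp only [int_q_pow]
    refine Continuous.aestronglyMeasurable ?_
    refine Continuous.div_const ?_ _
    refine continuous_finsetSum _ fun k _ => ?_
    exact (continuous_const.mul (cont_mono k)).mul continuous_const
  · intro n
    refine Eventually.of_forall fun x => ?_
    have := norm_integral_le_of_norm_le_const (μ := ν) (Eventually.of_forall fun y => bound_q lam x y n)
    simpa using this
  · exact Eventually.of_forall fun y => Real.summable_pow_div_factorial _
  · exact integrable_const _
  · exact Eventually.of_forall fun x => hasSum_W lam ν x

lemma int_int_q_pow (lam : Fin d → ℝ) (ν : Measure (Sph d)) [IsProbabilityMeasure ν] (n : ℕ) :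
    ∫ x, ∫ y, qA lam x.1 y.1 ^ n / n.factorial ∂ν ∂ν =
      (∑ k : Fin n → Fin d, (∏ j, lam (k j)) * (∫ y, mono k y ∂ν) * ∫ y, mono k y ∂ν) / n.factorial := by
  simp only [int_q_pow]
  rw [integral_div, integral_finsetSum]
  · simp only [integral_const_mul, integral_mul_const]
  · intro k _
    exact ((cont_int ν (cont_mono k)).const_mul _).mul_const _

/-- Positive definiteness of the kernel, tested on `ν - s δ_x - t δ_w`. -/
lemma psd (lam : Fin d → ℝ) (hpos : ∀ i, 0 < lam i) (ν : Measure (Sph d)) [IsProbabilityMeasure ν]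
    (x w : Sph d) (s t : ℝ) :
    0 ≤ IA lam ν - 2 * s * WA lam ν x - 2 * t * WA lam ν w + s ^ 2 * Kker lam x x
      + t ^ 2 * Kker lam w w + 2 * s * t * Kker lam x w := by
  have h := (((((hasSum_I lam ν).sub ((hasSum_W lam ν x).mul_left (2 * s))).sub
    ((hasSum_W lam ν w).mul_left (2 * t))).add ((hasSum_K lam x x).mul_left (s ^ 2))).add
    ((hasSum_K lam w w).mul_left (t ^ 2))).add ((hasSum_K lam x w).mul_left (2 * s * t))
  refine h.nonneg fun n => ?_
  rw [int_int_q_pow, int_q_pow, int_q_pow, q_pow, q_pow, q_pow]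
  have : ∀ a b c e f g N : ℝ, a / N - 2 * s * (b / N) - 2 * t * (c / N) + s ^ 2 * (e / N)
    + t ^ 2 * (f / N) + 2 * s * t * (g / N) =
      (a - 2 * s * b - 2 * t * c + s ^ 2 * e + t ^ 2 * f + 2 * s * t * g) / N := by
    intros; ring
  rw [this]
  refine div_nonneg ?_ (Nat.cast_nonneg _)
  simp only [Finset.mul_sum]
  rw [← Finset.sum_sub_distrib, ← Finset.sum_sub_distrib, ← Finset.sum_add_distrib,
    ← Finset.sum_add_distrib, ← Finset.sum_add_distrib]
  refine Finset.sum_nonneg fun k _ => ?_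
  have h2 : 0 ≤ (∏ j, lam (k j)) * ((∫ y, mono k y ∂ν) - s * mono k x - t * mono k w) ^ 2 :=
    mul_nonneg (Finset.prod_nonneg fun j _ => (hpos _).le) (sq_nonneg _)
  nlinarith [h2]

lemma null_compl_supp (ν : Measure (Sph d)) : ν (msupport ν)ᶜ = 0 := by
  refine measure_null_of_locally_null _ fun x hx => ?_
  simp only [msupport, Set.mem_compl_iff, Set.mem_ofPred_eq, not_forall] at hx
  obtain ⟨U, hU, hxU, h0⟩ := hx
  exact ⟨U, mem_nhdsWithin_of_mem_nhds (hU.mem_nhds hxU), by simpa using h0⟩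

lemma closed_supp (ν : Measure (Sph d)) : IsClosed (msupport ν) := by
  rw [← isOpen_compl_iff, isOpen_iff_forall_mem_open]
  intro x hx
  simp only [msupport, Set.mem_compl_iff, Set.mem_ofPred_eq, not_forall] at hx
  obtain ⟨U, hU, hxU, h0⟩ := hx
  exact ⟨U, fun y hy h => h0 (h U hU hy), hU, hxU⟩

lemma supp_nonempty (ν : Measure (Sph d)) [IsProbabilityMeasure ν] : (msupport ν).Nonempty := by
  by_contra h
  rw [Set.not_nonempty_iff_eq_empty] at h
  have := null_compl_supp ν
  rw [h] at this
  simp at this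

lemma eq_dirac_of_supp (ν : Measure (Sph d)) [IsProbabilityMeasure ν] (a : Sph d)
    (h : ∀ x ∈ msupport ν, x = a) : ν = Measure.dirac a := by
  have h0 : ν {a}ᶜ = 0 := measure_mono_null (Set.compl_subset_compl.2 fun x hx => h x hx) (null_compl_supp ν)
  have h1 : ν {a} = 1 := by
    have := (prob_compl_eq_zero_iff (μ := ν) (measurableSet_singleton a)).1 h0
    exact this
  ext s hs
  rw [Measure.dirac_apply' _ hs]
  by_cases ha : a ∈ s
  · simp only [Set.indicator_of_mem ha, Pi.one_apply]
    refine le_antisymm prob_le_one ?_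
    rw [← h1]
    exact measure_mono (by simpa using ha)
  · simp only [Set.indicator_of_notMem ha]
    exact measure_mono_null (by intro x hx hxa; exact ha (hxa ▸ hx)) h0

lemma IA_eq (lam : Fin d → ℝ) (ν : Measure (Sph d)) [IsProbabilityMeasure ν]
    (h : msupport ν ⊆ argmaxW lam ν) (x : Sph d) (hx : x ∈ msupport ν) : IA lam ν = WA lam ν x := by
  have : ∀ᵐ z ∂ν, WA lam ν z = WA lam ν x := by
    have h0 : ∀ᵐ z ∂ν, z ∈ msupport ν := null_compl_supp ν
    filter_upwards [h0] with z hz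
    exact le_antisymm (h hx z) (h hz x)
  have h2 := integral_congr_ae this
  have h3 : IA lam ν = ∫ z, WA lam ν z ∂ν := rfl
  rw [h3, h2]
  simp

/-- the part of the quadratic form off the first coordinate -/
def rA (lam : Fin d → ℝ) (i0 : Fin d) (x y : EuclideanSpace ℝ (Fin d)) : ℝ :=
  ∑ i ∈ Finset.univ.erase i0, lam i * x i * y i

lemma q_split (lam : Fin d → ℝ) (i0 : Fin d) (x y : EuclideanSpace ℝ (Fin d)) :
    qA lam x y = lam i0 * x i0 * y i0 + rA lam i0 x y :=
  (Finset.add_sum_erase _ (fun i => lam i * x i * y i) (Finset.mem_univ i0)).symm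

lemma sum_sq_erase (i0 : Fin d) (x : Sph d) : ∑ i ∈ Finset.univ.erase i0, x.1 i ^ 2 = 1 - x.1 i0 ^ 2 := by
  have := Finset.add_sum_erase Finset.univ (fun i => x.1 i ^ 2) (Finset.mem_univ i0)
  have h := sum_sq x
  simp only at this
  linarith

lemma r_le (lam : Fin d → ℝ) (hpos : ∀ i, 0 < lam i) (i0 : Fin d) (l : ℝ)
    (hl : ∀ i, i ≠ i0 → lam i ≤ l) (x y : Sph d) :
    rA lam i0 x.1 y.1 ≤ l * (1 - (x.1 i0 ^ 2 + y.1 i0 ^ 2) / 2) := by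
  have h1 := sum_sq_erase i0 x
  have h2 := sum_sq_erase i0 y
  have : l * (1 - (x.1 i0 ^ 2 + y.1 i0 ^ 2) / 2)
      = ∑ i ∈ Finset.univ.erase i0, l * ((x.1 i ^ 2 + y.1 i ^ 2) / 2) := by
    rw [← Finset.mul_sum, ← Finset.sum_div, Finset.sum_add_distrib, h1, h2]; ring
  rw [this]
  refine Finset.sum_le_sum fun i hi => ?_
  have h3 := hl i (Finset.ne_of_mem_erase hi)
  have h4 := hpos i
  have h5 : 0 ≤ (x.1 i ^ 2 + y.1 i ^ 2) / 2 := by positivity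
  nlinarith [mul_nonneg h4.le (sq_nonneg (x.1 i - y.1 i)), mul_le_mul_of_nonneg_right h3 h5]

lemma exp_chord (a b t : ℝ) (h0 : 0 ≤ t) (h1 : t ≤ 1) :
    rexp (t * a + (1 - t) * b) ≤ t * rexp a + (1 - t) * rexp b := by
  have := convexOn_exp.2 (Set.mem_univ a) (Set.mem_univ b) h0 (by linarith : 0 ≤ 1 - t) (by ring)
  simpa using this

/-- No two-cap configuration has energy above `Q`. -/
lemma two_cap (lam : Fin d → ℝ) (hpos : ∀ i, 0 < lam i) (i0 : Fin d) (l : ℝ) (hl0 : 0 < l)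
    (hl : ∀ i, i ≠ i0 → lam i ≤ l) (ν : Measure (Sph d)) [IsProbabilityMeasure ν]
    (h : msupport ν ⊆ argmaxW lam ν) (x w : Sph d) (hx : x ∈ msupport ν) (hw : w ∈ msupport ν)
    (hx0 : 0 ≤ x.1 i0) (hw0 : w.1 i0 ≤ 0) :
    IA lam ν ≤ max (rexp l) (Real.cosh (lam i0)) := by
  set Q := max (rexp l) (Real.cosh (lam i0)) with hQ
  have hQ1 : rexp l ≤ Q := le_max_left _ _
  have hQ2 : Real.cosh (lam i0) ≤ Q := le_max_right _ _
  have eW := IA_eq lam ν h x hx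
  have eW2 := IA_eq lam ν h w hw
  set M := IA lam ν with hM
  obtain ⟨t, ht⟩ : ∃ t, t = x.1 i0 := ⟨_, rfl⟩
  obtain ⟨r, hr⟩ : ∃ r, r = -w.1 i0 := ⟨_, rfl⟩
  have hwr : w.1 i0 = -r := by linarith
  have t0 : 0 ≤ t := by linarith
  have r0 : 0 ≤ r := by linarith
  have t1 : t ^ 2 ≤ 1 := by have := coord_sq_le x i0; rwa [← ht] at this
  have r1 : r ^ 2 ≤ 1 := by have := coord_sq_le w i0; rw [hwr] at this; linarith [neg_sq r]
  have tr1 : t * r ≤ 1 := by nlinarith [sq_nonneg (t - r)]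
  have tr0 : 0 ≤ t * r := mul_nonneg t0 r0
  have ha : Kker lam x x ≤ t ^ 2 * rexp (lam i0) + (1 - t ^ 2) * rexp l := by
    refine le_trans (Real.exp_le_exp.2 ?_) (exp_chord (lam i0) l (t ^ 2) (sq_nonneg t) t1)
    rw [q_split lam i0]
    have := r_le lam hpos i0 l hl x x
    rw [← ht] at this ⊢
    nlinarith
  have hb : Kker lam w w ≤ r ^ 2 * rexp (lam i0) + (1 - r ^ 2) * rexp l := by
    refine le_trans (Real.exp_le_exp.2 ?_) (exp_chord (lam i0) l (r ^ 2) (sq_nonneg r) r1)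
    rw [q_split lam i0]
    have := r_le lam hpos i0 l hl w w
    rw [hwr] at this ⊢
    nlinarith
  have hk : Kker lam x w ≤ (t * r) * rexp (-lam i0) + (1 - t * r) * rexp l := by
    refine le_trans (Real.exp_le_exp.2 ?_) (exp_chord (-lam i0) l (t * r) tr0 tr1)
    rw [q_split lam i0]
    have := r_le lam hpos i0 l hl x w
    rw [hwr, ← ht] at this ⊢
    nlinarith [mul_nonneg hl0.le (sq_nonneg (t - r))]
  rcases eq_or_lt_of_le t0 with h0 | h0
  · have := psd lam hpos ν x x 1 0
    rw [← hM, ← eW] at this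
    rw [← h0] at ha
    norm_num at ha this
    linarith
  have hs : 0 < t + r := by linarith
  have key : (t + r) ^ 2 * M ≤ r ^ 2 * Kker lam x x + t ^ 2 * Kker lam w w + 2 * t * r * Kker lam x w := by
    have := psd lam hpos ν x w (r / (t + r)) (t / (t + r))
    rw [← hM, ← eW, ← eW2] at this
    have h2 := mul_nonneg (sq_nonneg (t + r)) this
    field_simp at h2
    nlinarith
  have hc : rexp (lam i0) + rexp (-lam i0) = 2 * Real.cosh (lam i0) := by rw [Real.cosh_eq]; ring
  have k1 := mul_le_mul_of_nonneg_left ha (sq_nonneg r)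
  have k2 := mul_le_mul_of_nonneg_left hb (sq_nonneg t)
  have k3 := mul_le_mul_of_nonneg_left hk (by positivity : 0 ≤ 2 * t * r)
  have k4 : (t + r) ^ 2 * M ≤ ((t + r) ^ 2 - 4 * (t * r) ^ 2) * rexp l + 4 * (t * r) ^ 2 * Real.cosh (lam i0) := by
    have : 4 * (t * r) ^ 2 * Real.cosh (lam i0) = 2 * (t * r) ^ 2 * (rexp (lam i0) + rexp (-lam i0)) := by
      rw [hc]; ring
    rw [this]
    linarith
  have k5 : 0 ≤ (t + r) ^ 2 - 4 * (t * r) ^ 2 := by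
    have := mul_nonneg tr0 (sub_nonneg.2 tr1)
    linarith [sq_nonneg (t - r)]
  have k6 := mul_le_mul_of_nonneg_left hQ1 k5
  have k7 := mul_le_mul_of_nonneg_left hQ2 (by positivity : 0 ≤ 4 * (t * r) ^ 2)
  have k8 : (t + r) ^ 2 * M ≤ (t + r) ^ 2 * Q := by linarith
  exact le_of_mul_le_mul_left k8 (by positivity)

/-- One-cap configurations are polar Dirac masses. -/
lemma one_cap (lam : Fin d → ℝ) (hpos : ∀ i, 0 < lam i) (i0 : Fin d) (l : ℝ) (hl0 : 0 < l)
    (hl : ∀ i, i ≠ i0 → lam i ≤ l) (hgap : l < lam i0) (ν : Measure (Sph d)) [IsProbabilityMeasure ν]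
    (h : msupport ν ⊆ argmaxW lam ν) (ε : ℝ) (hε : ε ^ 2 = 1)
    (hc : ∀ x ∈ msupport ν, 0 < ε * x.1 i0) : ∀ x ∈ msupport ν, ε * x.1 i0 = 1 := by
  obtain ⟨x, hx, hmin⟩ := (closed_supp ν).isCompact.exists_isMinOn (supp_nonempty ν)
    ((continuous_const.mul (cont_coord i0)).continuousOn (f := fun x : Sph d => ε * x.1 i0))
  have hmin' : ∀ y ∈ msupport ν, ε * x.1 i0 ≤ ε * y.1 i0 := fun y hy => hmin hy
  have hle : ∀ y : Sph d, ε * y.1 i0 ≤ 1 := by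
    intro y
    have := coord_sq_le y i0
    have h2 : (ε * y.1 i0) ^ 2 ≤ 1 := by rw [mul_pow, hε]; linarith
    nlinarith
  suffices ¬ ε * x.1 i0 < 1 by
    intro y hy
    exact le_antisymm (hle y) (by linarith [hmin' y hy])
  intro hlt
  obtain ⟨t, ht⟩ : ∃ t, t = ε * x.1 i0 := ⟨_, rfl⟩
  have t0 : 0 < t := ht ▸ hc x hx
  rw [← ht] at hlt
  have hxt : x.1 i0 = ε * t := by rw [ht, ← mul_assoc, ← sq, hε, one_mul]
  have hx2 : x.1 i0 ^ 2 = t ^ 2 := by rw [hxt, mul_pow, hε, one_mul]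
  have t2 : 0 < 1 - t ^ 2 := by nlinarith
  obtain ⟨κ, hκ, hκ0, hκ1⟩ : ∃ κ : ℝ, 0 < (1 + κ) * lam i0 * t - l * (√(1 - κ ^ 2 * (1 - t ^ 2)) + t)
      ∧ 0 < κ ∧ κ < 1 := by
    have hcont : Continuous (fun κ : ℝ => (1 + κ) * lam i0 * t - l * (√(1 - κ ^ 2 * (1 - t ^ 2)) + t)) := by
      fun_prop
    have h1 : 0 < (1 + (1:ℝ)) * lam i0 * t - l * (√(1 - (1:ℝ) ^ 2 * (1 - t ^ 2)) + t) := by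
      have : (1 - (1:ℝ) ^ 2 * (1 - t ^ 2)) = t ^ 2 := by ring
      rw [this, Real.sqrt_sq t0.le]
      nlinarith
    have e1 : ∀ᶠ κ in 𝓝[<] (1:ℝ), 0 < (1 + κ) * lam i0 * t - l * (√(1 - κ ^ 2 * (1 - t ^ 2)) + t) :=
      nhdsWithin_le_nhds (hcont.continuousAt.eventually (lt_mem_nhds h1))
    have e2 : ∀ᶠ κ in 𝓝[<] (1:ℝ), 0 < κ := nhdsWithin_le_nhds (lt_mem_nhds one_pos)
    have e3 : ∀ᶠ κ in 𝓝[<] (1:ℝ), κ < 1 := eventually_mem_nhdsWithin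
    exact (e1.and (e2.and e3)).exists
  obtain ⟨u, hu⟩ : ∃ u, u = √(1 - κ ^ 2 * (1 - t ^ 2)) := ⟨_, rfl⟩
  have hu2 : u ^ 2 = 1 - κ ^ 2 * (1 - t ^ 2) := by
    rw [hu, Real.sq_sqrt]; nlinarith
  have hu0 : 0 ≤ u := hu ▸ Real.sqrt_nonneg _
  rw [← hu] at hκ
  let v0 : EuclideanSpace ℝ (Fin d) := WithLp.toLp 2 (fun i => if i = i0 then ε * u else κ * x.1 i)
  have hv0 : ∀ i, v0 i = if i = i0 then ε * u else κ * x.1 i := fun i => rfl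
  have hv : v0 ∈ Metric.sphere (0 : EuclideanSpace ℝ (Fin d)) 1 := by
    rw [mem_sphere_zero_iff_norm]
    have : ‖v0‖ ^ 2 = 1 := by
      rw [EuclideanSpace.norm_sq_eq]
      simp only [Real.norm_eq_abs, sq_abs]
      rw [← Finset.add_sum_erase _ _ (Finset.mem_univ i0)]
      have e : ∑ i ∈ Finset.univ.erase i0, v0 i ^ 2 = κ ^ 2 * (1 - x.1 i0 ^ 2) := by
        rw [← sum_sq_erase, Finset.mul_sum]
        refine Finset.sum_congr rfl fun i hi => ?_
        rw [hv0, if_neg (Finset.ne_of_mem_erase hi)]; ring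
      rw [e, hv0, if_pos rfl, mul_pow, hε, hu2, hx2]; ring
    have h3 := norm_nonneg v0
    nlinarith
  let v : Sph d := ⟨v0, hv⟩
  have hq : ∀ y ∈ msupport ν, qA lam x.1 y.1 < qA lam v.1 y.1 := by
    intro y hy
    rw [q_split lam i0 x.1, q_split lam i0 v.1]
    have e : rA lam i0 v.1 y.1 = κ * rA lam i0 x.1 y.1 := by
      unfold rA
      rw [Finset.mul_sum]
      refine Finset.sum_congr rfl fun i hi => ?_
      change lam i * v0 i * _ = _
      rw [hv0, if_neg (Finset.ne_of_mem_erase hi)]; ring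
    have e2 : v.1 i0 = ε * u := by change v0 i0 = _; rw [hv0, if_pos rfl]
    obtain ⟨r, hr⟩ : ∃ r, r = ε * y.1 i0 := ⟨_, rfl⟩
    have hyr : y.1 i0 = ε * r := by rw [hr, ← mul_assoc, ← sq, hε, one_mul]
    have hy2 : y.1 i0 ^ 2 = r ^ 2 := by rw [hyr, mul_pow, hε, one_mul]
    have htr : t ≤ r := by rw [ht, hr]; exact hmin' y hy
    have hR := r_le lam hpos i0 l hl x y
    rw [hx2, hy2] at hR
    have hR' : rA lam i0 x.1 y.1 ≤ l * (1 - t ^ 2) := hR.trans (by gcongr; nlinarith)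
    rw [e, e2, hxt, hyr]
    have a1 : lam i0 * (ε * t) * (ε * r) = lam i0 * t * r := by linear_combination lam i0 * t * r * hε
    have a2 : lam i0 * (ε * u) * (ε * r) = lam i0 * u * r := by linear_combination lam i0 * u * r * hε
    rw [a1, a2]
    have hut : (u - t) * (u + t) = (1 - κ) * (1 + κ) * (1 - t ^ 2) := by linear_combination hu2
    have hutpos : 0 < u + t := by linarith
    have b0 : 0 ≤ u - t := by
      have : 0 ≤ (u - t) * (u + t) := by
        rw [hut]; have : 0 < 1 - κ := by linarith
        positivity
      exact nonneg_of_mul_nonneg_left this hutpos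
    have b1 : (1 - κ) * (l * (1 - t ^ 2)) < lam i0 * (u - t) * t := by
      refine lt_of_mul_lt_mul_right ?_ hutpos.le
      have c : 0 < (1 - κ) * (1 - t ^ 2) := mul_pos (by linarith) t2
      have := mul_pos c hκ
      have e5 : lam i0 * (u - t) * t * (u + t) = lam i0 * t * ((1 - κ) * (1 + κ) * (1 - t ^ 2)) := by
        rw [← hut]; ring
      rw [e5]; nlinarith
    have b2 : lam i0 * (u - t) * t ≤ lam i0 * (u - t) * r :=
      mul_le_mul_of_nonneg_left htr (mul_nonneg (hpos i0).le b0)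
    have b3 := mul_le_mul_of_nonneg_left hR' (by linarith : 0 ≤ 1 - κ)
    nlinarith
  have hsupp : ∀ᵐ z ∂ν, z ∈ msupport ν := null_compl_supp ν
  have hWle := h hx v
  have hpos' : 0 < ∫ y, (Kker lam v y - Kker lam x y) ∂ν := by
    have hi : Integrable (fun y => Kker lam v y - Kker lam x y) ν :=
      (cont_int ν (cont_K lam v)).sub (cont_int ν (cont_K lam x))
    have hlt' : ∀ y ∈ msupport ν, 0 < Kker lam v y - Kker lam x y := fun y hy =>
      sub_pos.2 (Real.exp_lt_exp.2 (hq y hy))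
    rw [integral_pos_iff_support_of_nonneg_ae _ hi]
    · have : (msupport ν) ⊆ Function.support (fun y => Kker lam v y - Kker lam x y) :=
        fun y hy => (hlt' y hy).ne'
      refine lt_of_lt_of_le ?_ (measure_mono this)
      rw [(prob_compl_eq_zero_iff (closed_supp ν).measurableSet).1 (null_compl_supp ν)]
      exact one_pos
    · filter_upwards [hsupp] with y hy
      exact (hlt' y hy).le
  rw [integral_sub (cont_int ν (cont_K lam v)) (cont_int ν (cont_K lam x))] at hpos'
  change 0 < WA lam ν v - WA lam ν x at hpos'
  linarith

lemma pole_unique (i0 : Fin d) (x e : Sph d) (ε : ℝ) (hε : ε ^ 2 = 1) (hx : ε * x.1 i0 = 1)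
    (he : e.1 = EuclideanSpace.single i0 ε) : x = e := by
  have hx1 : x.1 i0 = ε := by linear_combination ε * hx - x.1 i0 * hε
  have h := sum_sq_erase i0 x
  rw [hx1, hε, sub_self, Finset.sum_eq_zero_iff_of_nonneg (fun i _ => sq_nonneg _)] at h
  apply Subtype.ext
  rw [he]
  ext i
  by_cases hi : i = i0
  · subst hi; simpa using hx1
  · have := h i (Finset.mem_erase.2 ⟨hi, Finset.mem_univ i⟩)
    have h0 : x.1 i = 0 := by simpa using this
    rw [h0]; simp [hi]

lemma supp_dirac (a : Sph d) : msupport (Measure.dirac a) ⊆ {a} := by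
  intro x hx
  by_contra hne
  have := hx {a}ᶜ isOpen_compl_singleton hne
  simp at this

lemma single_mem (i : Fin d) : (EuclideanSpace.single i (1:ℝ)) ∈ Metric.sphere (0 : EuclideanSpace ℝ (Fin d)) 1 := by
  simp

lemma q_single (lam : Fin d → ℝ) (x : EuclideanSpace ℝ (Fin d)) (i : Fin d) (c : ℝ) :
    qA lam x (EuclideanSpace.single i c) = lam i * x i * c := by
  unfold qA
  rw [Finset.sum_eq_single i]
  · simp
  · intro j _ hj
    simp [hj]
  · simp

lemma coord_le (x : Sph d) (i : Fin d) : x.1 i ≤ 1 := by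
  have := coord_sq_le x i
  nlinarith

lemma dirac_mem (lam : Fin d → ℝ) (hpos : ∀ i, 0 < lam i) (i : Fin d) (e : Sph d)
    (he : e.1 = EuclideanSpace.single i 1) :
    msupport (Measure.dirac e) ⊆ argmaxW lam (Measure.dirac e) ∧ IA lam (Measure.dirac e) = rexp (lam i) := by
  have hW : ∀ x, WA lam (Measure.dirac e) x = rexp (lam i * x.1 i) := by
    intro x
    unfold WA Kker
    rw [integral_dirac, he, q_single, mul_one]
  have hei : e.1 i = 1 := by rw [he]; simp
  constructor
  · intro x hx y
    have hxe : x = e := supp_dirac e hx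
    rw [hxe, hW, hW, hei]
    exact Real.exp_le_exp.2 (mul_le_mul_of_nonneg_left (coord_le y i) (hpos i).le)
  · have : IA lam (Measure.dirac e) = ∫ x, WA lam (Measure.dirac e) x ∂(Measure.dirac e) := rfl
    rw [this, integral_dirac, hW, hei, mul_one]

def half2 (a b : Sph d) : Measure (Sph d) :=
  (2⁻¹ : NNReal) • Measure.dirac a + (2⁻¹ : NNReal) • Measure.dirac b

lemma int_half2 (a b : Sph d) {f : Sph d → ℝ} (hf : Continuous f) :
    ∫ x, f x ∂(half2 a b) = (f a + f b) / 2 := by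
  unfold half2
  rw [integral_add_measure (cont_int _ hf) (cont_int _ hf), integral_smul_nnreal_measure,
    integral_smul_nnreal_measure, integral_dirac, integral_dirac]
  simp only [NNReal.smul_def, smul_eq_mul]
  push_cast
  ring

instance (a b : Sph d) : IsProbabilityMeasure (half2 a b) := by
  constructor
  unfold half2
  simp only [Measure.add_apply, Measure.smul_apply, measure_univ]
  rw [← add_smul]
  have : (2⁻¹ + 2⁻¹ : NNReal) = 1 := by
    rw [← two_mul]; exact mul_inv_cancel₀ two_ne_zero
  rw [this, one_smul]

lemma supp_half2 (a b : Sph d) : msupport (half2 a b) ⊆ {a, b} := by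
  intro x hx
  by_contra hne
  have := hx {a, b}ᶜ (Set.toFinite {a, b}).isClosed.isOpen_compl hne
  simp [half2] at this

lemma half2_mem (lam : Fin d → ℝ) (i : Fin d) (e : Sph d)
    (he : e.1 = EuclideanSpace.single i 1) :
    msupport (half2 e (antip e)) ⊆ argmaxW lam (half2 e (antip e)) ∧
      IA lam (half2 e (antip e)) = Real.cosh (lam i) := by
  have hei : e.1 i = 1 := by rw [he]; simp
  have hae : (antip e).1 = EuclideanSpace.single i (-1) := by
    change -e.1 = _
    rw [he]; ext j; by_cases hj : j = i <;> simp [hj]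
  have hai : (antip e).1 i = -1 := by rw [hae]; simp
  have hW : ∀ x, WA lam (half2 e (antip e)) x = Real.cosh (lam i * x.1 i) := by
    intro x
    unfold WA
    rw [int_half2 _ _ (cont_K lam x), Real.cosh_eq]
    unfold Kker
    rw [he, hae, q_single, q_single, mul_one, mul_neg, mul_one]
  constructor
  · intro x hx y
    have hx2 : Real.cosh (lam i * x.1 i) = Real.cosh (lam i) := by
      rcases supp_half2 _ _ hx with h | h
      · rw [h, hei, mul_one]
      · rw [Set.mem_singleton_iff] at h
        rw [h, hai, mul_neg, mul_one, Real.cosh_neg]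
    rw [hW, hW, hx2, Real.cosh_le_cosh, abs_mul]
    have : |y.1 i| ≤ 1 := abs_le_one_iff_mul_self_le_one.2 (by have := coord_sq_le y i; nlinarith)
    nlinarith [abs_nonneg (lam i)]
  · have : IA lam (half2 e (antip e)) = ∫ x, WA lam (half2 e (antip e)) x ∂(half2 e (antip e)) := rfl
    rw [this]
    simp only [hW]
    rw [int_half2, hei, hai, mul_one, mul_neg, mul_one, Real.cosh_neg]
    · ring
    · have := cont_coord (d := d) i
      exact Real.continuous_cosh.comp (continuous_const.mul this)

/-- sharp first-excited max-support bound. -/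
theorem stmt3 (d : ℕ) (hd : 2 ≤ d) (lam : Fin d → ℝ)
    (hanti : Antitone lam)
    (hgap : lam ⟨1, by omega⟩ < lam ⟨0, by omega⟩)
    (hpos : ∀ i, 0 < lam i)
    (e1 : Sph d)
    (he1 : (e1 : EuclideanSpace ℝ (Fin d)) = EuclideanSpace.single ⟨0, by omega⟩ 1) :
    IsLUB {r : ℝ | ∃ ν : Measure (Sph d),
        (IsProbabilityMeasure ν ∧ msupport ν ⊆ argmaxW lam ν) ∧
        ν ≠ Measure.dirac e1 ∧ ν ≠ Measure.dirac (antip e1) ∧ IA lam ν = r}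
      (max (Real.exp (lam ⟨1, by omega⟩)) (Real.cosh (lam ⟨0, by omega⟩))) ∧
    (max (Real.exp (lam ⟨1, by omega⟩)) (Real.cosh (lam ⟨0, by omega⟩))) < Real.exp (lam ⟨0, by omega⟩) := by
  set i0 : Fin d := ⟨0, by omega⟩ with hi0
  set i1 : Fin d := ⟨1, by omega⟩ with hi1
  have hl : ∀ i, i ≠ i0 → lam i ≤ lam i1 := by
    intro i hi
    apply hanti
    rw [Fin.le_def]
    have : i.val ≠ 0 := fun h => hi (Fin.ext h)
    change 1 ≤ i.val
    omega
  have hpole : ∀ ν : Measure (Sph d), IA lam ν ≠ rexp (lam i0) →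
      ν ≠ Measure.dirac e1 ∧ ν ≠ Measure.dirac (antip e1) := by
    intro ν hν
    constructor
    · rintro rfl
      exact hν (dirac_mem lam hpos i0 e1 he1).2
    · rintro rfl
      apply hν
      unfold IA
      rw [integral_dirac, integral_dirac]
      unfold Kker
      have hae : (antip e1).1 = EuclideanSpace.single i0 (-1) := by
        change -e1.1 = _
        rw [he1]; ext j; by_cases hj : j = i0 <;> simp [hj]
      rw [hae, q_single]
      simp
  have hlt1 : rexp (lam i1) < rexp (lam i0) := Real.exp_lt_exp.2 hgap
  have hlt2 : Real.cosh (lam i0) < rexp (lam i0) := by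
    rw [Real.cosh_eq]
    have : rexp (-lam i0) < rexp (lam i0) := Real.exp_lt_exp.2 (by linarith [hpos i0])
    linarith
  refine ⟨⟨?_, ?_⟩, max_lt hlt1 hlt2⟩
  · rintro r ⟨ν, ⟨hP, hs⟩, hn1, hn2, rfl⟩
    by_contra hcon
    have htwo : ∀ x ∈ msupport ν, ∀ w ∈ msupport ν, 0 ≤ x.1 i0 → w.1 i0 ≤ 0 → False :=
      fun x hx w hw h1 h2 =>
        hcon (two_cap lam hpos i0 (lam i1) (hpos i1) hl ν hs x w hx hw h1 h2)
    obtain ⟨x, hx⟩ := supp_nonempty ν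
    rcases lt_or_ge 0 (x.1 i0) with h0 | h0
    · have hc : ∀ y ∈ msupport ν, 0 < (1:ℝ) * y.1 i0 := fun y hy => by
        rw [one_mul]
        by_contra hne
        exact htwo x hx y hy h0.le (not_lt.1 hne)
      have := one_cap lam hpos i0 (lam i1) (hpos i1) hl hgap ν hs 1 (by norm_num) hc
      exact hn1 (eq_dirac_of_supp ν e1 fun y hy =>
        pole_unique i0 y e1 1 (by norm_num) (this y hy) he1)
    · have hc : ∀ y ∈ msupport ν, 0 < (-1:ℝ) * y.1 i0 := fun y hy => by
        by_contra hne
        exact htwo y hy x hx (by linarith) h0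
      have := one_cap lam hpos i0 (lam i1) (hpos i1) hl hgap ν hs (-1) (by norm_num) hc
      have hae : (antip e1).1 = EuclideanSpace.single i0 (-1) := by
        change -e1.1 = _
        rw [he1]; ext j; by_cases hj : j = i0 <;> simp [hj]
      exact hn2 (eq_dirac_of_supp ν (antip e1) fun y hy =>
        pole_unique i0 y (antip e1) (-1) (by norm_num) (this y hy) hae)
  · intro b hb
    refine max_le (hb ?_) (hb ?_)
    · have h := dirac_mem lam hpos i1 ⟨EuclideanSpace.single i1 1, single_mem i1⟩ rfl
      have hne := hpole _ (by rw [h.2]; exact hlt1.ne)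
      exact ⟨_, ⟨inferInstance, h.1⟩, hne.1, hne.2, h.2⟩
    · have h := half2_mem lam i0 e1 he1
      have hne := hpole _ (by rw [h.2]; exact hlt2.ne)
      exact ⟨_, ⟨inferInstance, h.1⟩, hne.1, hne.2, h.2⟩

end
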